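/- arXiv:2006.14171 — 6 statements merged into one kernel-verified Lean document; each statement's English description precedes it below -/
import Mathlib

section
/- For every n ≥ 1, every subset V ⊆ Fin n, every M ∈ ℝ, every l ∈ ℝⁿ, every j ∈ Fin n, and every valid coordinate i ∈ V, the partial derivative with respect to the i-th coordinate of the function l ↦ log(softmax(mask_{V,M}(l))_j) at l equals (1 if i = j else 0) − softmax(mask_{V,M}(l))_i. -/
noncomputable def softmax {n : ℕ} (l : Fin n → ℝ) (i : Fin n) : ℝ :=
  Real.exp (l i) / ∑ j, Real.exp (l j)

def maskLogits {n : ℕ} (V : Finset (Fin n)) (M : ℝ) (l : Fin n → ℝ) (i : Fin n) : ℝ :=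
  if i ∈ V then l i else M

theorem sum_exp_pos {n : ℕ} (l : Fin n → ℝ) (i : Fin n) : 0 < ∑ k, Real.exp (l k) :=
  Finset.sum_pos (fun _ _ => Real.exp_pos _) ⟨i, Finset.mem_univ i⟩

theorem log_softmax {n : ℕ} (l : Fin n → ℝ) (j : Fin n) :
    Real.log (softmax l j) = l j - Real.log (∑ k, Real.exp (l k)) := by
  rw [softmax, Real.log_div (Real.exp_pos _).ne' (sum_exp_pos l j).ne', Real.log_exp]

theorem maskLogits_update_of_mem {n : ℕ} {V : Finset (Fin n)} {i : Fin n} (hi : i ∈ V)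
    (M : ℝ) (l : Fin n → ℝ) (t : ℝ) :
    maskLogits V M (Function.update l i t) = Function.update (maskLogits V M l) i t := by
  ext k
  by_cases hk : k = i
  · subst hk
    simp [maskLogits, hi]
  · simp [maskLogits, hk]

theorem hasDerivAt_log_softmax_update {n : ℕ} (l : Fin n → ℝ) (i j : Fin n) :
    HasDerivAt (fun t : ℝ => Real.log (softmax (Function.update l i t) j))
      ((if i = j then (1 : ℝ) else 0) - softmax l i) (l i) := by
  have hcoord (k : Fin n) : HasDerivAt (fun t : ℝ => Function.update l i t k)
      (if i = k then (1 : ℝ) else 0) (l i) := by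
    simpa [Pi.single_apply, eq_comm] using hasDerivAt_pi.1 (hasDerivAt_update l i (l i)) k
  have hsum : HasDerivAt (fun t : ℝ => ∑ k, Real.exp (Function.update l i t k))
      (Real.exp (l i)) (l i) := by
    simpa using HasDerivAt.fun_sum (u := Finset.univ) fun k _ => (hcoord k).exp
  simp only [log_softmax]
  have hlog := hsum.log (by simpa using (sum_exp_pos l i).ne')
  simpa [softmax] using (hcoord j).fun_sub hlog

theorem masked_log_policy_partial_deriv_valid (n : ℕ) (hn : 1 ≤ n) (V : Finset (Fin n))
    (M : ℝ) (l : Fin n → ℝ) (j : Fin n) (i : Fin n) (hi : i ∈ V) :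
    HasDerivAt (fun t : ℝ => Real.log (softmax (maskLogits V M (Function.update l i t)) j))
      ((if i = j then (1 : ℝ) else 0) - softmax (maskLogits V M l) i) (l i) := by
  have h := hasDerivAt_log_softmax_update (maskLogits V M l) i j
  have hval : maskLogits V M l i = l i := if_pos hi
  rw [hval] at h
  simpa only [maskLogits_update_of_mem hi] using h
end

section
/- For every n ≥ 1, every nonempty subset V ⊆ Fin n, every M ∈ ℝ, every l ∈ ℝⁿ, and every invalid coordinate i ∉ V, the probability that invalid action masking assigns to the invalid action satisfies softmax(mask_{V,M}(l))_i ≤ exp(M − max_{j∈V} l_j); in particular it can be made arbitrarily small by choosing M sufficiently negative. -/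
/-- A softmax probability is at most the exponential of the difference to any other logit. -/
theorem softmax_le_exp_sub {n : ℕ} (l : Fin n → ℝ) (i j : Fin n) :
    softmax l i ≤ Real.exp (l i - l j) := by
  rw [softmax, Real.exp_sub]
  gcongr
  exact Finset.single_le_sum (f := fun k => Real.exp (l k))
    (fun k _ => (Real.exp_pos _).le) (Finset.mem_univ j)

theorem masked_invalid_prob_le (n : ℕ) (hn : 1 ≤ n) (V : Finset (Fin n)) (hV : V.Nonempty)
    (M : ℝ) (l : Fin n → ℝ) (i : Fin n) (hi : i ∉ V) :
    softmax (maskLogits V M l) i ≤ Real.exp (M - V.sup' hV l) := by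
  obtain ⟨j, hj, hsup⟩ := V.exists_mem_eq_sup' hV l
  simpa [hsup, maskLogits, hi, hj] using softmax_le_exp_sub (maskLogits V M l) i j
end

section
/- For every n ≥ 1, every nonempty subset V ⊆ Fin n, every M ∈ ℝ, and every l ∈ ℝⁿ, the total probability that invalid action masking assigns to invalid actions satisfies Σ_{i∉V} softmax(mask_{V,M}(l))_i ≤ (n − |V|)·exp(M − max_{j∈V} l_j), where |V| denotes the cardinality of V. -/
theorem masked_total_invalid_prob_le (n : ℕ) (hn : 1 ≤ n) (V : Finset (Fin n))
    (hV : V.Nonempty) (M : ℝ) (l : Fin n → ℝ) :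
    ∑ i ∈ Vᶜ, softmax (maskLogits V M l) i ≤
      ((n - V.card : ℕ) : ℝ) * Real.exp (M - V.sup' hV l) := by
  obtain ⟨j, hj, hmax⟩ := V.exists_mem_eq_sup' hV l
  have hbound : ∀ i ∈ Vᶜ, softmax (maskLogits V M l) i ≤ Real.exp (M - V.sup' hV l) := by
    intro i hi
    simpa [maskLogits, Finset.mem_compl.mp hi, hj, hmax] using
      softmax_le_exp_sub (maskLogits V M l) i j
  simpa [Finset.card_compl] using Finset.sum_le_card_nsmul _ _ _ hbound
end

section
/- For every n ≥ 1, every nonempty subset V ⊆ Fin n, every l ∈ ℝⁿ, and every invalid coordinate i ∉ V, the probability softmax(mask_{V,M}(l))_i tends to 0 as the masking constant M tends to −∞. -/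
theorem masked_invalid_prob_tendsto_zero (n : ℕ) (hn : 1 ≤ n) (V : Finset (Fin n))
    (hV : V.Nonempty) (l : Fin n → ℝ) (i : Fin n) (hi : i ∉ V) :
    Filter.Tendsto (fun M : ℝ => softmax (maskLogits V M l) i) Filter.atBot (nhds 0) := by
  obtain ⟨k, hk⟩ := hV
  have hlim : Filter.Tendsto (fun M : ℝ => Real.exp M / Real.exp (l k)) Filter.atBot (nhds 0) := by
    simpa using Real.tendsto_exp_atBot.div_const (Real.exp (l k))
  refine squeeze_zero (fun M => ?_) (fun M => ?_) hlim
  · unfold softmax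
    positivity
  · have hden : Real.exp (l k) ≤ ∑ j, Real.exp (maskLogits V M l j) := by
      simpa [maskLogits, hk] using
        Finset.single_le_sum (f := fun j => Real.exp (maskLogits V M l j))
          (fun j _ => (Real.exp_pos _).le) (Finset.mem_univ k)
    have hnum : maskLogits V M l i = M := if_neg hi
    rw [softmax, hnum]
    gcongr
end

section
/- For every n ≥ 1, every nonempty subset V ⊆ Fin n, every l ∈ ℝⁿ, and every valid coordinate i ∈ V, the probability softmax(mask_{V,M}(l))_i tends to exp(l_i) / Σ_{j∈V} exp(l_j) as the masking constant M tends to −∞; that is, in the limit the masked policy is the softmax distribution renormalized over the valid actions only. -/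
theorem sum_exp_maskLogits {n : ℕ} (V : Finset (Fin n)) (M : ℝ) (l : Fin n → ℝ) :
    ∑ j, Real.exp (maskLogits V M l j) =
      ∑ j ∈ V, Real.exp (l j) + (Vᶜ.card : ℝ) * Real.exp M := by
  rw [← Finset.sum_add_sum_compl V, ← nsmul_eq_mul, ← Finset.sum_const]
  congr 1
  · exact Finset.sum_congr rfl fun j hj => by simp [maskLogits, hj]
  · exact Finset.sum_congr rfl fun j hj => by simp [maskLogits, Finset.mem_compl.mp hj]

theorem masked_valid_prob_tendsto_renormalized (n : ℕ) (hn : 1 ≤ n) (V : Finset (Fin n))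
    (hV : V.Nonempty) (l : Fin n → ℝ) (i : Fin n) (hi : i ∈ V) :
    Filter.Tendsto (fun M : ℝ => softmax (maskLogits V M l) i) Filter.atBot
      (nhds (Real.exp (l i) / ∑ j ∈ V, Real.exp (l j))) := by
  have hpos : 0 < ∑ j ∈ V, Real.exp (l j) := Finset.sum_pos (fun j _ => Real.exp_pos _) hV
  have hmask : ∀ M, maskLogits V M l i = l i := fun M => by simp [maskLogits, hi]
  simp only [softmax, sum_exp_maskLogits, hmask]
  refine tendsto_const_nhds.div ?_ hpos.ne'
  simpa using (Real.tendsto_exp_atBot.const_mul (Vᶜ.card : ℝ)).const_add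
    (∑ j ∈ V, Real.exp (l j))
end

section
/- For every n ≥ 1, every subset V ⊆ Fin n, every l ∈ ℝⁿ, and every invalid coordinate i ∉ V, the function M ↦ softmax(mask_{V,M}(l))_i from ℝ to ℝ is strictly monotone increasing whenever V is nonempty; consequently, choosing M more negative strictly reduces the probability assigned to any invalid action. -/
theorem masked_invalid_prob_strictMono (n : ℕ) (hn : 1 ≤ n) (V : Finset (Fin n))
    (hV : V.Nonempty) (l : Fin n → ℝ) (i : Fin n) (hi : i ∉ V) :
    StrictMono (fun M : ℝ => softmax (maskLogits V M l) i) := by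
  intro a b hab
  have hexp : Real.exp a < Real.exp b := Real.exp_lt_exp.mpr hab
  have hpos (M : ℝ) : 0 < ∑ j, Real.exp (maskLogits V M l j) :=
    Finset.sum_pos (fun j _ => Real.exp_pos _) ⟨i, Finset.mem_univ i⟩
  have hmask (M : ℝ) : maskLogits V M l i = M := if_neg hi
  simp only [softmax, hmask]
  rw [div_lt_div_iff₀ (hpos a) (hpos b), Finset.mul_sum, Finset.mul_sum]
  have hvalid : ∀ j ∈ V, Real.exp a * Real.exp (maskLogits V b l j) <
      Real.exp b * Real.exp (maskLogits V a l j) := by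
    intro j hj
    simp only [maskLogits, if_pos hj]
    exact mul_lt_mul_of_pos_right hexp (Real.exp_pos _)
  obtain ⟨k, hk⟩ := hV
  refine Finset.sum_lt_sum (fun j _ => ?_) ⟨k, Finset.mem_univ k, hvalid k hk⟩
  by_cases hj : j ∈ V
  · exact (hvalid j hj).le
  · simp only [maskLogits, if_neg hj]
    exact (mul_comm _ _).le
end
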